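/- Let c be a normalized Hochschild 2-cocycle with trivial coefficients on A = A_s(n,d), let A⁺ = ker ε, and set λ_{ij} = −c(u_{ii}, u_{ij}) for all indices i, j. Then there exists a unital algebra homomorphism ρ_c : A → End(ℂ × A⁺ × ℂ) such that for all i, j, ρ_c(u_{ij})(α, v, β) = (δ_{ij}α + c(u_{ij}, v) + λ_{ij}β, u_{ij}·v + β(u_{ij} − δ_{ij}1), δ_{ij}β). -/

import Mathlib

open scoped BigOperators

/-- The relations presenting the quantum permutation algebra `A_s(n,d)`. -/
inductive ASRel (n : ℕ) (d : Matrix (Fin n) (Fin n) ℂ) :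
    FreeAlgebra ℂ (Fin n × Fin n) → FreeAlgebra ℂ (Fin n × Fin n) → Prop
  | row_orth (i j k : Fin n) :
      ASRel n d (FreeAlgebra.ι ℂ (i, j) * FreeAlgebra.ι ℂ (i, k))
        (if j = k then FreeAlgebra.ι ℂ (i, j) else 0)
  | col_orth (i j k : Fin n) :
      ASRel n d (FreeAlgebra.ι ℂ (j, i) * FreeAlgebra.ι ℂ (k, i))
        (if j = k then FreeAlgebra.ι ℂ (j, i) else 0)
  | row_sum (i : Fin n) : ASRel n d (∑ j, FreeAlgebra.ι ℂ (i, j)) 1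
  | col_sum (i : Fin n) : ASRel n d (∑ j, FreeAlgebra.ι ℂ (j, i)) 1
  | inter (i j : Fin n) :
      ASRel n d (∑ k, d i k • FreeAlgebra.ι ℂ (k, j)) (∑ k, d k j • FreeAlgebra.ι ℂ (i, k))

/-- The quantum permutation algebra `A_s(n,d)`. -/
abbrev ASAlg (n : ℕ) (d : Matrix (Fin n) (Fin n) ℂ) := RingQuot (ASRel n d)

/-- The generators `u_{ij}` of `A_s(n,d)`. -/
noncomputable def ASu {n : ℕ} (d : Matrix (Fin n) (Fin n) ℂ) (i j : Fin n) : ASAlg n d :=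
  RingQuot.mkAlgHom ℂ (ASRel n d) (FreeAlgebra.ι ℂ (i, j))

/-- The counit `ε : A_s(n,d) → ℂ`, the unique algebra map with `ε(u_{ij}) = δ_{ij}`. -/
noncomputable def ASeps (n : ℕ) (d : Matrix (Fin n) (Fin n) ℂ) : ASAlg n d →ₐ[ℂ] ℂ :=
  RingQuot.liftAlgHom ℂ
    ⟨FreeAlgebra.lift ℂ (fun p => if p.1 = p.2 then (1 : ℂ) else 0), by
      intro a b h
      induction h with
      | row_orth i j k =>
          simp only [map_mul, FreeAlgebra.lift_ι_apply, apply_ite, map_zero]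
          split_ifs <;> simp_all
      | col_orth i j k =>
          simp only [map_mul, FreeAlgebra.lift_ι_apply, apply_ite, map_zero]
          split_ifs <;> simp_all
      | row_sum i =>
          simp [FreeAlgebra.lift_ι_apply]
      | col_sum i =>
          simp [FreeAlgebra.lift_ι_apply]
      | inter i j =>
          simp [FreeAlgebra.lift_ι_apply, smul_ite]⟩

lemma ASeps_u {n : ℕ} (d : Matrix (Fin n) (Fin n) ℂ) (i j : Fin n) :
    ASeps n d (ASu d i j) = if i = j then 1 else 0 := by
  simp [ASeps, ASu, RingQuot.liftAlgHom_mkAlgHom_apply, FreeAlgebra.lift_ι_apply]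

/-- The element `u_{ij}·v + β(u_{ij} − δ_{ij}1)` lies in the augmentation ideal
`A⁺ = ker ε` of `A_s(n,d)` whenever `v` does. -/
lemma ASmem_aux (n : ℕ) (d : Matrix (Fin n) (Fin n) ℂ) (i j : Fin n) (v : ASAlg n d)
    (hv : v ∈ LinearMap.ker (ASeps n d).toLinearMap) (β : ℂ) :
    ASu d i j * v + β • (ASu d i j - (if i = j then 1 else 0)) ∈
      LinearMap.ker (ASeps n d).toLinearMap := by
  simp only [LinearMap.mem_ker, AlgHom.toLinearMap_apply] at hv ⊢
  rw [map_add, map_mul, hv, mul_zero, map_smul, map_sub, ASeps_u, zero_add]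
  split_ifs <;> simp

section Cocycle

variable {A : Type*} [Ring A] [Algebra ℂ A] {ε : A →ₐ[ℂ] ℂ} {c : A →ₗ[ℂ] A →ₗ[ℂ] ℂ}

/-- The operator on `ℂ × A` attached to `(a, l)`: it extends left multiplication by `a` on `A`
to an upper triangular operator with off-diagonal part `c a + l • ε`. -/
noncomputable def cocycleOp (ε : A →ₐ[ℂ] ℂ) (c : A →ₗ[ℂ] A →ₗ[ℂ] ℂ) :
    A × ℂ →ₗ[ℂ] Module.End ℂ (ℂ × A) :=
  LinearMap.mk₂ ℂ (fun p q => (ε p.1 * q.1 + c p.1 q.2 + p.2 * ε q.2, p.1 * q.2))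
    (fun p p' q => by
      ext
      · simp; ring
      · simp [add_mul])
    (fun r p q => by
      ext
      · simp; ring
      · simp)
    (fun p q q' => by
      ext
      · simp; ring
      · simp [mul_add])
    (fun r p q => by
      ext
      · simp; ring
      · simp)

lemma cocycleOp_apply (p : A × ℂ) (q : ℂ × A) :
    cocycleOp ε c p q = (ε p.1 * q.1 + c p.1 q.2 + p.2 * ε q.2, p.1 * q.2) :=
  rfl

lemma cocycleOp_mul
    (hc : ∀ a b x : A, ε a * c b x - c (a * b) x + c a (b * x) - c a b * ε x = 0)
    (p q : A × ℂ) :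
    cocycleOp ε c p * cocycleOp ε c q =
      cocycleOp ε c (p.1 * q.1, ε p.1 * q.2 + p.2 * ε q.1 + c p.1 q.1) := by
  refine LinearMap.ext fun x => ?_
  simp only [Module.End.mul_apply, cocycleOp_apply, Prod.mk.injEq, map_mul, mul_assoc, and_true]
  linear_combination hc p.1 q.1 x.2

lemma cocycle_one_left
    (hc : ∀ a b x : A, ε a * c b x - c (a * b) x + c a (b * x) - c a b * ε x = 0)
    (h1 : c 1 1 = 0) (x : A) : c 1 x = 0 := by
  simpa [h1] using hc 1 1 x

lemma cocycle_one_right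
    (hc : ∀ a b x : A, ε a * c b x - c (a * b) x + c a (b * x) - c a b * ε x = 0)
    (h1 : c 1 1 = 0) (x : A) : c x 1 = 0 := by
  simpa [h1] using hc x 1 1

lemma cocycleOp_one
    (hc : ∀ a b x : A, ε a * c b x - c (a * b) x + c a (b * x) - c a b * ε x = 0)
    (h1 : c 1 1 = 0) : cocycleOp ε c (1, 0) = 1 := by
  refine LinearMap.ext fun x => ?_
  simp [cocycleOp_apply, cocycle_one_left hc h1]

lemma cocycle_idem_self
    (hc : ∀ a b x : A, ε a * c b x - c (a * b) x + c a (b * x) - c a b * ε x = 0)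
    {p q : A} (hpq : p * q = 0) (hq : q * q = q) (hεp : ε p = 1) (hεq : ε q = 0) :
    c q q = -c p q := by
  have h := hc p q q
  simp only [hpq, hq, hεp, hεq, map_zero, LinearMap.zero_apply] at h
  linear_combination h

lemma cocycle_idem_comm
    (hc : ∀ a b x : A, ε a * c b x - c (a * b) x + c a (b * x) - c a b * ε x = 0)
    {p q : A} (hpq : p * q = 0) (hqp : q * p = 0) (hq : q * q = q) (hεp : ε p = 1)
    (hεq : ε q = 0) : c q p = c p q := by
  have h := hc q q p
  simp only [hqp, hq, hεp, hεq, map_zero] at h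
  linear_combination -h - cocycle_idem_self hc hpq hq hεp hεq

lemma cocycle_idem_eq_zero
    (hc : ∀ a b x : A, ε a * c b x - c (a * b) x + c a (b * x) - c a b * ε x = 0)
    {q r : A} (hqr : q * r = 0) (hq : q * q = q) (hεq : ε q = 0) (hεr : ε r = 0) :
    c q r = 0 := by
  simpa [hqr, hq, hεq, hεr] using hc q q r

/-- The splitting `A = ker ε ⊕ ℂ1` of an augmented algebra, with an extra summand `ℂ`. -/
noncomputable def augSplit (ε : A →ₐ[ℂ] ℂ) :
    (ℂ × ↥(LinearMap.ker ε.toLinearMap) × ℂ) ≃ₗ[ℂ] ℂ × A where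
  toFun x := (x.1, (x.2.1 : A) + x.2.2 • (1 : A))
  invFun y := (y.1, ⟨y.2 - ε y.2 • (1 : A), by simp⟩, ε y.2)
  map_add' x y := by
    ext
    · simp
    · simp only [Prod.fst_add, Prod.snd_add, Submodule.coe_add, add_smul]
      abel
  map_smul' r x := by
    ext
    · simp
    · simp [mul_smul]
  left_inv := by
    rintro ⟨α, ⟨v, hv⟩, β⟩
    have hv' : ε v = 0 := by simpa using hv
    simp [hv']
  right_inv y := by simp

end Cocycle

section Relations

variable {n : ℕ} (d : Matrix (Fin n) (Fin n) ℂ)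

lemma ASu_row_orth (i j k : Fin n) :
    ASu d i j * ASu d i k = if j = k then ASu d i j else 0 := by
  have h := RingQuot.mkAlgHom_rel ℂ (ASRel.row_orth (d := d) i j k)
  simpa only [ASu, map_mul, apply_ite (RingQuot.mkAlgHom ℂ (ASRel n d)), map_zero] using h

lemma ASu_col_orth (i j k : Fin n) :
    ASu d j i * ASu d k i = if j = k then ASu d j i else 0 := by
  have h := RingQuot.mkAlgHom_rel ℂ (ASRel.col_orth (d := d) i j k)
  simpa only [ASu, map_mul, apply_ite (RingQuot.mkAlgHom ℂ (ASRel n d)), map_zero] using h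

lemma ASu_row_sum (i : Fin n) : ∑ j, ASu d i j = 1 := by
  have h := RingQuot.mkAlgHom_rel ℂ (ASRel.row_sum (d := d) i)
  simpa only [ASu, map_sum, map_one] using h

lemma ASu_col_sum (i : Fin n) : ∑ j, ASu d j i = 1 := by
  have h := RingQuot.mkAlgHom_rel ℂ (ASRel.col_sum (d := d) i)
  simpa only [ASu, map_sum, map_one] using h

lemma ASu_inter (i j : Fin n) :
    ∑ k, d i k • ASu d k j = ∑ k, d k j • ASu d i k := by
  have h := RingQuot.mkAlgHom_rel ℂ (ASRel.inter (d := d) i j)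
  simpa only [ASu, map_sum, map_smul] using h

lemma ASu_mul_self (i j : Fin n) : ASu d i j * ASu d i j = ASu d i j := by
  simp [ASu_row_orth]

variable {d} {c : ASAlg n d →ₗ[ℂ] ASAlg n d →ₗ[ℂ] ℂ}

lemma AScocycle_self
    (hc : ∀ a b x : ASAlg n d,
      ASeps n d a * c b x - c (a * b) x + c a (b * x) - c a b * ASeps n d x = 0)
    {i j : Fin n} (hij : i ≠ j) :
    c (ASu d i j) (ASu d i j) = -c (ASu d i i) (ASu d i j) :=
  cocycle_idem_self hc (by simp [ASu_row_orth, hij]) (ASu_mul_self d i j)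
    (by simp [ASeps_u]) (by simp [ASeps_u, hij])

lemma AScocycle_row_comm
    (hc : ∀ a b x : ASAlg n d,
      ASeps n d a * c b x - c (a * b) x + c a (b * x) - c a b * ASeps n d x = 0)
    (i j : Fin n) :
    c (ASu d i j) (ASu d i i) = c (ASu d i i) (ASu d i j) := by
  rcases eq_or_ne i j with rfl | hij
  · rfl
  · exact cocycle_idem_comm hc (by simp [ASu_row_orth, hij]) (by simp [ASu_row_orth, hij.symm])
      (ASu_mul_self d i j) (by simp [ASeps_u]) (by simp [ASeps_u, hij])

lemma AScocycle_col_comm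
    (hc : ∀ a b x : ASAlg n d,
      ASeps n d a * c b x - c (a * b) x + c a (b * x) - c a b * ASeps n d x = 0)
    (i j : Fin n) :
    c (ASu d i j) (ASu d j j) = c (ASu d j j) (ASu d i j) := by
  rcases eq_or_ne i j with rfl | hij
  · rfl
  · exact cocycle_idem_comm hc (by simp [ASu_col_orth, hij.symm]) (by simp [ASu_col_orth, hij])
      (ASu_mul_self d i j) (by simp [ASeps_u]) (by simp [ASeps_u, hij])

lemma AScocycle_diag
    (hc : ∀ a b x : ASAlg n d,
      ASeps n d a * c b x - c (a * b) x + c a (b * x) - c a b * ASeps n d x = 0)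
    (i j : Fin n) :
    c (ASu d j j) (ASu d i j) = c (ASu d i i) (ASu d i j) := by
  rcases eq_or_ne i j with rfl | hij
  · rfl
  · have h := cocycle_idem_self hc (p := ASu d j j) (q := ASu d i j)
      (by simp [ASu_col_orth, hij.symm])
      (ASu_mul_self d i j) (by simp [ASeps_u]) (by simp [ASeps_u, hij])
    linear_combination h - AScocycle_self hc hij

lemma AScocycle_row_orth
    (hc : ∀ a b x : ASAlg n d,
      ASeps n d a * c b x - c (a * b) x + c a (b * x) - c a b * ASeps n d x = 0)
    (i j k : Fin n) :
    (if i = j then 1 else 0) * -c (ASu d i i) (ASu d i k) +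
        -c (ASu d i i) (ASu d i j) * (if i = k then 1 else 0) + c (ASu d i j) (ASu d i k) =
      if j = k then -c (ASu d i i) (ASu d i j) else 0 := by
  rcases eq_or_ne i j with rfl | hij
  · rcases eq_or_ne i k with rfl | hik <;> simp [*]
  · rcases eq_or_ne i k with rfl | hik
    · simp [hij, hij.symm, AScocycle_row_comm hc]
    · rcases eq_or_ne j k with rfl | hjk
      · simp [hij, AScocycle_self hc hij]
      · simpa [hij, hik, hjk] using cocycle_idem_eq_zero hc
          (by simp [ASu_row_orth, hjk]) (ASu_mul_self d i j)
          (by simp [ASeps_u, hij]) (by simp [ASeps_u, hik])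

lemma AScocycle_col_orth
    (hc : ∀ a b x : ASAlg n d,
      ASeps n d a * c b x - c (a * b) x + c a (b * x) - c a b * ASeps n d x = 0)
    (i j k : Fin n) :
    (if j = i then 1 else 0) * -c (ASu d k k) (ASu d k i) +
        -c (ASu d j j) (ASu d j i) * (if k = i then 1 else 0) + c (ASu d j i) (ASu d k i) =
      if j = k then -c (ASu d j j) (ASu d j i) else 0 := by
  rcases eq_or_ne j i with rfl | hji
  · rcases eq_or_ne j k with rfl | hjk
    · simp
    · simp [hjk, hjk.symm, AScocycle_diag hc k j]
  · rcases eq_or_ne k i with rfl | hki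
    · simp [hji, AScocycle_col_comm hc j k, AScocycle_diag hc j k]
    · rcases eq_or_ne j k with rfl | hjk
      · simp [hji, AScocycle_self hc hji]
      · simpa [hji, hki, hjk] using cocycle_idem_eq_zero hc
          (by simp [ASu_col_orth, hjk]) (ASu_mul_self d j i)
          (by simp [ASeps_u, hji]) (by simp [ASeps_u, hki])

lemma AScocycle_inter
    (hc : ∀ a b x : ASAlg n d,
      ASeps n d a * c b x - c (a * b) x + c a (b * x) - c a b * ASeps n d x = 0)
    (i j : Fin n) :
    ∑ k, d i k * c (ASu d k k) (ASu d k j) = ∑ k, d k j * c (ASu d i i) (ASu d i k) := by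
  have hleft : ASu d i i * ∑ k, d i k • ASu d k j = d i j • ASu d i i := by
    simp [ASu_inter, Finset.mul_sum, ASu_row_orth]
  have hright : (∑ k, d i k • ASu d k j) * ASu d j j = d i j • ASu d j j := by
    simp [Finset.sum_mul, ASu_col_orth]
  have h := hc (ASu d i i) (∑ k, d i k • ASu d k j) (ASu d j j)
  rw [hleft, hright] at h
  simp only [ASeps_u, if_true, map_smul, LinearMap.smul_apply] at h
  have h₁ : c (∑ k, d i k • ASu d k j) (ASu d j j) =
      ∑ k, d i k * c (ASu d k k) (ASu d k j) := by
    simp [AScocycle_col_comm hc, fun k => AScocycle_diag hc k j]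
  have h₂ : c (ASu d i i) (∑ k, d i k • ASu d k j) =
      ∑ k, d k j * c (ASu d i i) (ASu d i k) := by
    simp [ASu_inter]
  linear_combination h - h₁ + h₂

end Relations

/-- Lemma 5.3: for a normalized Hochschild 2-cocycle `c` with trivial
coefficients on `A = A_s(n,d)` and `λ_{ij} = −c(u_{ii}, u_{ij})`, there is a unital algebra
homomorphism `ρ_c : A → End(ℂ × A⁺ × ℂ)` with
`ρ_c(u_{ij})(α, v, β) = (δ_{ij}α + c(u_{ij}, v) + λ_{ij}β, u_{ij}v + β(u_{ij} − δ_{ij}1), δ_{ij}β)`. -/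
theorem exists_rho_c (n : ℕ) (hn : 1 ≤ n) (d : Matrix (Fin n) (Fin n) ℂ)
    (c : ASAlg n d →ₗ[ℂ] ASAlg n d →ₗ[ℂ] ℂ)
    (hcocycle : ∀ a b x : ASAlg n d,
      ASeps n d a * c b x - c (a * b) x + c a (b * x) - c a b * ASeps n d x = 0)
    (hnorm : c 1 1 = 0) :
    ∃ ρ : ASAlg n d →ₐ[ℂ] Module.End ℂ (ℂ × ↥(LinearMap.ker (ASeps n d).toLinearMap) × ℂ),
      ∀ (i j : Fin n) (α : ℂ) (v : ↥(LinearMap.ker (ASeps n d).toLinearMap)) (β : ℂ),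
        ρ (ASu d i j) (α, v, β) =
          ((if i = j then (1 : ℂ) else 0) * α + c (ASu d i j) ↑v
              + (-c (ASu d i i) (ASu d i j)) * β,
           ⟨ASu d i j * ↑v + β • (ASu d i j - (if i = j then 1 else 0)),
             ASmem_aux n d i j ↑v v.2 β⟩,
           (if i = j then (1 : ℂ) else 0) * β) := by
  let T := cocycleOp (ASeps n d) c
  let g : Fin n × Fin n → ASAlg n d × ℂ := fun p =>
    (ASu d p.1 p.2, -c (ASu d p.1 p.1) (ASu d p.1 p.2))
  have hT : ∀ ⦃a b : FreeAlgebra ℂ (Fin n × Fin n)⦄, ASRel n d a b →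
      FreeAlgebra.lift ℂ (fun p => T (g p)) a = FreeAlgebra.lift ℂ (fun p => T (g p)) b := by
    intro a b h
    induction h with
    | row_orth i j k =>
      have := AScocycle_row_orth hcocycle i j k
      simp only [map_mul, FreeAlgebra.lift_ι_apply, T, g, cocycleOp_mul hcocycle, ASeps_u, this,
        ASu_row_orth]
      split_ifs
      · simp
      · rw [map_zero]
        exact map_zero _
    | col_orth i j k =>
      have := AScocycle_col_orth hcocycle i j k
      simp only [map_mul, FreeAlgebra.lift_ι_apply, T, g, cocycleOp_mul hcocycle, ASeps_u, this,
        ASu_col_orth]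
      split_ifs
      · simp
      · rw [map_zero]
        exact map_zero _
    | row_sum i =>
      rw [map_one, ← cocycleOp_one hcocycle hnorm]
      simp only [map_sum, FreeAlgebra.lift_ι_apply]
      rw [← map_sum]
      congr 1
      ext
      · simp [g, Prod.fst_sum, ASu_row_sum]
      · simp [g, Prod.snd_sum, ← map_sum, ASu_row_sum, cocycle_one_right hcocycle hnorm]
    | col_sum i =>
      rw [map_one, ← cocycleOp_one hcocycle hnorm]
      simp only [map_sum, FreeAlgebra.lift_ι_apply]
      rw [← map_sum]
      congr 1
      ext
      · simp [g, Prod.fst_sum, ASu_col_sum]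
      · simp [g, Prod.snd_sum, fun k => (AScocycle_diag hcocycle k i).symm, ← map_sum, ASu_col_sum,
          cocycle_one_right hcocycle hnorm]
    | inter i j =>
      simp only [map_sum, map_smul, FreeAlgebra.lift_ι_apply]
      simp only [← map_smul, ← map_sum]
      congr 1
      ext
      · simp [g, Prod.fst_sum, ASu_inter]
      · simp [g, Prod.snd_sum, AScocycle_inter hcocycle]
  refine ⟨((augSplit (ASeps n d)).symm.conjAlgEquiv ℂ).toAlgHom.comp
    (RingQuot.liftAlgHom ℂ ⟨FreeAlgebra.lift ℂ (fun p => T (g p)), hT⟩), fun i j α v β => ?_⟩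
  have hv : ASeps n d v = 0 := v.2
  have hu : RingQuot.liftAlgHom ℂ ⟨FreeAlgebra.lift ℂ (fun p => T (g p)), hT⟩ (ASu d i j) =
      T (g (i, j)) := by
    rw [ASu, RingQuot.liftAlgHom_mkAlgHom_apply, FreeAlgebra.lift_ι_apply]
  simp only [AlgHom.comp_apply, hu]
  change (augSplit (ASeps n d)).symm (T (g (i, j)) (augSplit (ASeps n d) (α, v, β))) = _
  rw [LinearEquiv.symm_apply_eq]
  ext
  · simp [T, g, cocycleOp_apply, augSplit, ASeps_u, hv, cocycle_one_right hcocycle hnorm]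
  · simp [T, g, cocycleOp_apply, augSplit, mul_add, smul_sub]
    abel
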